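/- There are no real numbers κ, Q, Q′, m, m′ satisfying all of the following: κ > 0; Q > κ; m < −(Q²/(2κ) + Q/2); 0 ≤ Q′ ≤ 3mκ/(2Q) + Q + κ/2; and −(Q′²/(2κ) + Q′/2) ≤ m′ ≤ (Q − Q′)²/(2κ) + (Q + Q′)/2 + m. (This is the arithmetic core of the inductive step in the proof of the Castelnuovo-type bound: if the invariant of degree Q violates the Castelnuovo bound m ≥ −(Q²/(2κ) + Q/2) for Q > κ, then no admissible destabilizing pair (Q′, m′) satisfying the wall-location bound Q′ ≤ 3mκ/(2Q) + Q + κ/2 and the two-sided bound on m′ can exist.) -/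

import Mathlib

/-- Arithmetic core of the inductive step of the Castelnuovo bound: there is no
configuration (κ, Q, Q', m, m') with κ > 0, Q > κ, m below the Castelnuovo bound,
0 ≤ Q' ≤ 3mκ/(2Q) + Q + κ/2, and −(Q'²/(2κ) + Q'/2) ≤ m' ≤ (Q−Q')²/(2κ) + (Q+Q')/2 + m. -/
theorem castelnuovo_inductive_step : ¬ ∃ κ Q Q' m m' : ℝ,
    0 < κ ∧ κ < Q ∧ m < -(Q^2/(2*κ) + Q/2) ∧
    0 ≤ Q' ∧ Q' ≤ 3*m*κ/(2*Q) + Q + κ/2 ∧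
    -(Q'^2/(2*κ) + Q'/2) ≤ m' ∧ m' ≤ (Q - Q')^2/(2*κ) + (Q + Q')/2 + m := by
  rintro ⟨κ, Q, Q', m, m', hκ, hQ, hm, hQ', hwall, hlow, hupp⟩
  have hQ0 : 0 < Q := hκ.trans hQ
  have hmκ : m * κ < -(Q ^ 2 + Q * κ) / 2 := by
    have h := mul_lt_mul_of_pos_right hm hκ
    have e : -(Q ^ 2 / (2 * κ) + Q / 2) * κ = -(Q ^ 2 + Q * κ) / 2 := by
      field_simp
    linarith
  have hslope : 3 * m * κ / (2 * Q) < -(3 / 4) * (Q + κ) := by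
    rw [div_lt_iff₀ (by positivity)]
    linarith
  have hbound : Q' < (Q - κ) / 4 := by linarith
  have hsum : 0 ≤ (Q' ^ 2 / (2 * κ) + Q' / 2 + ((Q - Q') ^ 2 / (2 * κ) + (Q + Q') / 2 + m)) * κ :=
    mul_nonneg (by linarith) hκ.le
  have e : (Q' ^ 2 / (2 * κ) + Q' / 2 + ((Q - Q') ^ 2 / (2 * κ) + (Q + Q') / 2 + m)) * κ
      = Q' * (Q' - Q + κ) + (Q ^ 2 + Q * κ) / 2 + m * κ := by
    field_simp
    ring
  have hneg : Q' * (Q' - Q + κ) ≤ 0 := mul_nonpos_of_nonneg_of_nonpos hQ' (by linarith)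
  linarith
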